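/- For every α ∈ ℂ \ {0}, every z ∈ ℂ \ {0} with z² ∉ {q^k : k ∈ ℤ}, and every n ∈ ℤ, the connection formula holds: f_n(z) = (θ_q(α z^{−1}) / θ_q(z^{−2})) · g_n(z) + (θ_q(α z) / θ_q(z²)) · g_n(z^{−1}). -/

import Mathlib

open Complex Filter Topology

/-- Finite q-Pochhammer symbol `(a;q)_n`. -/
noncomputable def qp (q a : ℂ) (n : ℕ) : ℂ := ∏ k ∈ Finset.range n, (1 - a * q ^ k)

/-- Infinite q-Pochhammer symbol `(a;q)_∞`. -/
noncomputable def qpInf (q a : ℂ) : ℂ := ∏' k : ℕ, (1 - a * q ^ k)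

/-- Theta function `θ_q(x) = (x;q)_∞ (q/x;q)_∞`. -/
noncomputable def theta (q x : ℂ) : ℂ := qpInf q x * qpInf q (q / x)

/-- Regularized confluent basic hypergeometric series `₁φ̃₁(0;b;q,w)`. -/
noncomputable def phiT (q b w : ℂ) : ℂ :=
  ∑' k : ℕ, qpInf q (b * q ^ k) * (-1) ^ k * q ^ (k * (k - 1) / 2) * w ^ k / qp q q k

/-- The solution `f_n(z)`. -/
noncomputable def fseq (q α z : ℂ) (n : ℤ) : ℂ :=
  (-1) ^ n * α ^ (-n) * q ^ (n * (n + 1) / 2) *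
    phiT q (q ^ (n + 1) / (α * z)) (z * q ^ (n + 1) / α)

/-- The solution `g_n(z)`. -/
noncomputable def gseq (q α z : ℂ) (n : ℤ) : ℂ :=
  z ^ (-n) * phiT q (α * z * q ^ (1 - n)) (q * z ^ 2)

section QPochhammer

variable {q : ℂ}

lemma summable_norm_mul_pow (hq : ‖q‖ < 1) (a : ℂ) : Summable fun k : ℕ => ‖-(a * q ^ k)‖ := by
  simp only [norm_neg, norm_mul, norm_pow]
  exact (summable_geometric_of_lt_one (norm_nonneg q) hq).mul_left _

lemma multipliable_qpInf (hq : ‖q‖ < 1) (a : ℂ) : Multipliable fun k : ℕ => 1 - a * q ^ k := by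
  simpa only [sub_eq_add_neg] using multipliable_one_add_of_summable (summable_norm_mul_pow hq a)

lemma tendsto_qp (hq : ‖q‖ < 1) (a : ℂ) : Tendsto (qp q a) atTop (𝓝 (qpInf q a)) :=
  (multipliable_qpInf hq a).tendsto_prod_tprod_nat

lemma qpInf_eq_mul (hq : ‖q‖ < 1) (a : ℂ) : qpInf q a = (1 - a) * qpInf q (a * q) := by
  have h : Multipliable fun k : ℕ => 1 - a * q ^ (k + 1) := by
    simpa only [pow_succ', mul_assoc] using multipliable_qpInf hq (a * q)
  have h1 := tprod_eq_zero_mul' (f := fun k : ℕ => 1 - a * q ^ k) h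
  simpa only [qpInf, pow_succ', mul_assoc, pow_zero, mul_one] using h1

lemma qpInf_ne_zero (hq : ‖q‖ < 1) {a : ℂ} (ha : ∀ k : ℕ, a * q ^ k ≠ 1) : qpInf q a ≠ 0 := by
  simpa only [qpInf, sub_eq_add_neg] using
    tprod_one_add_ne_zero_of_summable (f := fun k : ℕ => -(a * q ^ k))
      (fun k h => ha k (by linear_combination -h)) (summable_norm_mul_pow hq a)

lemma norm_qpInf_sub_one_le (hq : ‖q‖ < 1) (a : ℂ) :
    ‖qpInf q a - 1‖ ≤ Real.exp (‖a‖ / (1 - ‖q‖)) - 1 := by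
  refine le_of_tendsto ((tendsto_qp hq a).sub_const 1).norm (Eventually.of_forall fun n => ?_)
  have h := Finset.norm_prod_one_add_sub_one_le (Finset.range n) fun k : ℕ => -(a * q ^ k)
  simp only [← sub_eq_add_neg] at h
  refine h.trans ?_
  gcongr
  refine ((summable_norm_mul_pow hq a).sum_le_tsum _ fun _ _ => norm_nonneg _).trans_eq ?_
  simp only [norm_neg, norm_mul, norm_pow]
  rw [tsum_mul_left, tsum_geometric_of_lt_one (norm_nonneg q) hq, div_eq_mul_inv]

lemma norm_qpInf_le (hq : ‖q‖ < 1) (a : ℂ) : ‖qpInf q a‖ ≤ Real.exp (‖a‖ / (1 - ‖q‖)) := by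
  have h := norm_add_le (qpInf q a - 1) 1
  rw [sub_add_cancel, norm_one] at h
  linarith [norm_qpInf_sub_one_le hq a]

lemma tendsto_qpInf_one (hq : ‖q‖ < 1) {ι : Type*} {l : Filter ι} {u : ι → ℂ}
    (hu : Tendsto u l (𝓝 0)) : Tendsto (fun i => qpInf q (u i)) l (𝓝 1) := by
  rw [tendsto_iff_norm_sub_tendsto_zero]
  refine squeeze_zero (fun _ => norm_nonneg _) (fun i => norm_qpInf_sub_one_le hq (u i)) ?_
  have h : Tendsto (fun i => Real.exp (‖u i‖ / (1 - ‖q‖)) - 1) l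
      (𝓝 (Real.exp (‖(0 : ℂ)‖ / (1 - ‖q‖)) - 1)) :=
    ((Real.continuous_exp.tendsto _).comp (hu.norm.div_const _)).sub_const 1
  simpa using h

lemma tendsto_mul_pow_zero (hq : ‖q‖ < 1) (a : ℂ) :
    Tendsto (fun k : ℕ => a * q ^ k) atTop (𝓝 0) := by
  simpa using (tendsto_pow_atTop_nhds_zero_of_norm_lt_one hq).const_mul a

lemma qpInf_zero : qpInf q 0 = 1 := by simp [qpInf]

lemma one_sub_pow_succ_ne_zero (hq : ‖q‖ < 1) (k : ℕ) : 1 - q ^ (k + 1) ≠ 0 := by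
  intro h
  have h1 : ‖q ^ (k + 1)‖ = 1 := by rw [← sub_eq_zero.1 h, norm_one]
  rw [norm_pow] at h1
  exact absurd h1 (pow_lt_one₀ (norm_nonneg q) hq k.succ_ne_zero).ne

end QPochhammer

section Confluent

variable {q : ℂ}

/-- The coefficient of `(b q^k;q)_∞ w^k` in `₁φ̃₁(0;b;q,w)`. -/
noncomputable def phiCoeff (q : ℂ) (k : ℕ) : ℂ := (-1) ^ k * q ^ (k * (k - 1) / 2) / qp q q k

lemma phiT_eq_tsum (q b w : ℂ) :
    phiT q b w = ∑' k : ℕ, qpInf q (b * q ^ k) * (phiCoeff q k * w ^ k) := by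
  simp only [phiT, phiCoeff]
  exact tsum_congr fun k => by ring

lemma phiCoeff_zero : phiCoeff q 0 = 1 := by simp [phiCoeff, qp]

lemma phiCoeff_succ (q : ℂ) (k : ℕ) :
    phiCoeff q (k + 1) = -(q ^ k / (1 - q ^ (k + 1))) * phiCoeff q k := by
  have h : (k + 1) * (k + 1 - 1) / 2 = k * (k - 1) / 2 + k := by
    exact Nat.triangle_succ k
  rw [phiCoeff, phiCoeff, h, qp, qp, Finset.prod_range_succ, pow_add, ← pow_succ']
  simp only [div_eq_mul_inv, mul_inv]
  ring

lemma summable_phiCoeff (hq : ‖q‖ < 1) (w : ℂ) : Summable fun k => ‖phiCoeff q k * w ^ k‖ := by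
  have hlim : Tendsto (fun k : ℕ => -(q ^ k / (1 - q ^ (k + 1))) * w) atTop (𝓝 0) := by
    have h0 := tendsto_pow_atTop_nhds_zero_of_norm_lt_one hq
    have h1 := (h0.div (((tendsto_add_atTop_iff_nat 1).2 h0).const_sub 1) (by simp)).neg.mul_const w
    simpa using h1
  refine summable_of_ratio_norm_eventually_le (r := 1 / 2) (by norm_num) ?_
  have h2 := hlim.norm.eventually_le_const (u := 1 / 2) (by norm_num)
  filter_upwards [h2] with k hk
  rw [norm_norm, norm_norm, phiCoeff_succ, pow_succ w,
    show -(q ^ k / (1 - q ^ (k + 1))) * phiCoeff q k * (w ^ k * w) =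
      -(q ^ k / (1 - q ^ (k + 1))) * w * (phiCoeff q k * w ^ k) by ring, norm_mul]
  gcongr

lemma summable_phiT (hq : ‖q‖ < 1) (b w : ℂ) :
    Summable fun k : ℕ => qpInf q (b * q ^ k) * (phiCoeff q k * w ^ k) := by
  refine Summable.of_norm_bounded
    ((summable_phiCoeff hq w).mul_left (Real.exp (‖b‖ / (1 - ‖q‖)))) fun k => ?_
  rw [norm_mul]
  gcongr
  refine (norm_qpInf_le hq _).trans ?_
  have h0 : 0 < 1 - ‖q‖ := by linarith
  gcongr
  rw [norm_mul, norm_pow]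
  exact mul_le_of_le_one_right (norm_nonneg b) (pow_le_one₀ (norm_nonneg q) hq.le)

lemma phiT_sub_left (hq : ‖q‖ < 1) (b w : ℂ) :
    phiT q b w - phiT q (b * q) w = -b * phiT q (b * q) (w * q) := by
  simp only [phiT_eq_tsum]
  rw [← (summable_phiT hq b w).tsum_sub (summable_phiT hq (b * q) w), ← tsum_mul_left]
  refine tsum_congr fun k => ?_
  rw [qpInf_eq_mul hq (b * q ^ k), mul_pow, show b * q ^ k * q = b * q * q ^ k by ring]
  ring

lemma phiT_sub_right (hq : ‖q‖ < 1) (b w : ℂ) :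
    phiT q b w - phiT q b (w * q) = -w * phiT q (b * q) (w * q) := by
  simp only [phiT_eq_tsum]
  have hs := (summable_phiT hq b w).sub (summable_phiT hq b (w * q))
  rw [← (summable_phiT hq b w).tsum_sub (summable_phiT hq b (w * q)), hs.tsum_eq_zero_add,
    ← tsum_mul_left]
  simp only [pow_zero, sub_self, zero_add]
  refine tsum_congr fun k => ?_
  rw [phiCoeff_succ, mul_pow, mul_pow, show b * q ^ (k + 1) = b * q * q ^ k by ring]
  field_simp [one_sub_pow_succ_ne_zero hq k]
  ring

lemma tendsto_phiT (hq : ‖q‖ < 1) {b w : ℕ → ℂ} {w₀ : ℂ} (hb : Tendsto b atTop (𝓝 0))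
    (hw : Tendsto w atTop (𝓝 w₀)) :
    Tendsto (fun n => phiT q (b n) (w n)) atTop (𝓝 (phiT q 0 w₀)) := by
  simp only [phiT_eq_tsum]
  refine tendsto_tsum_of_dominated_convergence
    (bound := fun k => Real.exp (1 / (1 - ‖q‖)) * ‖phiCoeff q k * ((‖w₀‖ + 1 : ℝ) : ℂ) ^ k‖)
    ((summable_phiCoeff hq _).mul_left _) (fun k => ?_) ?_
  · rw [zero_mul, qpInf_zero]
    refine (tendsto_qpInf_one hq ?_).mul ((hw.pow k).const_mul _)
    simpa using hb.mul_const (q ^ k)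
  · filter_upwards [hb.norm.eventually_le_const (u := 1) (by simp),
      hw.norm.eventually_le_const (lt_add_one ‖w₀‖)] with n hbn hwn k
    have h0 : 0 < 1 - ‖q‖ := by linarith
    rw [norm_mul, norm_mul, norm_mul (phiCoeff q k), norm_pow, norm_pow, Complex.norm_real,
      Real.norm_of_nonneg (by positivity)]
    gcongr
    refine (norm_qpInf_le hq _).trans ?_
    gcongr
    rw [norm_mul, norm_pow]
    exact (mul_le_of_le_one_right (norm_nonneg _) (pow_le_one₀ (norm_nonneg q) hq.le)).trans hbn

lemma phiT_zero_zero : phiT q 0 0 = 1 := by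
  rw [phiT_eq_tsum, tsum_eq_single 0 fun k hk => by simp [hk]]
  simp [qpInf_zero, phiCoeff_zero]

/-- Euler's expansion of `(w;q)_∞`. -/
lemma phiT_zero_left (hq : ‖q‖ < 1) (w : ℂ) : phiT q 0 w = qpInf q w := by
  have hfin : ∀ n : ℕ, phiT q 0 w = qp q w n * phiT q 0 (w * q ^ n) := by
    intro n
    induction n with
    | zero => simp [qp]
    | succ n ih =>
      have h := phiT_sub_right hq 0 (w * q ^ n)
      rw [zero_mul, show w * q ^ n * q = w * q ^ (n + 1) by ring] at h
      rw [ih, qp, qp, Finset.prod_range_succ]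
      linear_combination (∏ k ∈ Finset.range n, (1 - w * q ^ k)) * h
  have hlim := (tendsto_qp hq w).mul
    (tendsto_phiT hq (b := fun _ => 0) tendsto_const_nhds (tendsto_mul_pow_zero hq w))
  rw [phiT_zero_zero, mul_one] at hlim
  exact tendsto_nhds_unique (tendsto_const_nhds.congr hfin) hlim

end Confluent

section Recurrence

variable {q : ℂ}

/-- The prefactor `(-1)^n α^{-n} q^{n(n+1)/2}` of `f_n`. -/
noncomputable def fPrefactor (q α : ℂ) (n : ℤ) : ℂ :=
  (-1) ^ n * α ^ (-n) * q ^ (n * (n + 1) / 2)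

lemma fPrefactor_zero (q α : ℂ) : fPrefactor q α 0 = 1 := by simp [fPrefactor]

lemma fPrefactor_succ (hq0 : q ≠ 0) {α : ℂ} (hα : α ≠ 0) (n : ℤ) :
    fPrefactor q α (n + 1) = -(q ^ (n + 1) / α) * fPrefactor q α n := by
  have h : (n + 1) * (n + 1 + 1) / 2 = n * (n + 1) / 2 + (n + 1) := by
    rw [show (n + 1) * (n + 1 + 1) = n * (n + 1) + (n + 1) * 2 by ring,
      Int.add_mul_ediv_right _ _ two_ne_zero]
  rw [fPrefactor, fPrefactor, h, zpow_add₀ hq0, zpow_add₀ (by norm_num : (-1 : ℂ) ≠ 0),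
    show -(n + 1) = -n + -1 by ring, zpow_add₀ hα]
  simp only [zpow_neg_one, zpow_one]
  field_simp

lemma fPrefactor_mul (q α z : ℂ) (n : ℤ) :
    fPrefactor q (α * z) n = fPrefactor q α n * z ^ (-n) := by
  rw [fPrefactor, fPrefactor, mul_zpow]
  ring

lemma fseq_recurrence (hq : ‖q‖ < 1) (hq0 : q ≠ 0) {α z : ℂ} (hα : α ≠ 0) (hz : z ≠ 0) (n : ℤ) :
    fseq q α z n + fseq q α z (n + 2) = (z + z⁻¹ - α * q ^ (-(n + 1))) * fseq q α z (n + 1) := by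
  have e0 := fPrefactor_succ hq0 hα n
  have e1 := fPrefactor_succ hq0 hα (n + 1)
  set Q := q ^ (n + 1) with hQ
  have hQ0 : Q ≠ 0 := zpow_ne_zero _ hq0
  have hQ1 : q ^ (n + 1 + 1) = Q * q := by rw [zpow_add_one₀ hq0]
  have hQ2 : q ^ (n + 2 + 1) = Q * q * q := by
    rw [show n + 2 + 1 = n + 1 + 1 + 1 by ring, zpow_add_one₀ hq0, hQ1]
  have hf : ∀ m, fseq q α z m =
      fPrefactor q α m * phiT q (q ^ (m + 1) / (α * z)) (z * q ^ (m + 1) / α) := fun m => rfl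
  rw [hQ1] at e1
  rw [hf, hf, hf, hQ1, hQ2, ← hQ, show n + 2 = n + 1 + 1 by ring, e1, e0, zpow_neg, ← hQ]
  have r1 := phiT_sub_left hq (Q / (α * z)) (z * Q / α)
  have r2 := phiT_sub_right hq (Q / (α * z) * q) (z * Q / α)
  have r3 := phiT_sub_left hq (Q / (α * z) * q) (z * Q / α * q)
  rw [show Q / (α * z) * q * q = Q * q * q / (α * z) by ring,
    show z * Q / α * q * q = z * (Q * q * q) / α by ring,
    show Q / (α * z) * q = Q * q / (α * z) by ring,
    show z * Q / α * q = z * (Q * q) / α by ring] at *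
  generalize phiT q (Q / (α * z)) (z * Q / α) = P0 at *
  generalize phiT q (Q * q / (α * z)) (z * Q / α) = P1 at *
  generalize phiT q (Q * q / (α * z)) (z * (Q * q) / α) = P2 at *
  generalize phiT q (Q * q * q / (α * z)) (z * (Q * q) / α) = P3 at *
  have h0 : P0 = P2 - z * Q / α * P3 - Q / (α * z) * P2 := by linear_combination r1 + r2
  have h3 : P3 = P2 + Q * q / (α * z) * phiT q (Q * q * q / (α * z)) (z * (Q * q * q) / α) := by
    linear_combination -r3
  rw [h0, h3]
  field_simp
  ring

lemma gseq_recurrence (hq : ‖q‖ < 1) (hq0 : q ≠ 0) {z : ℂ} (hz : z ≠ 0) (α : ℂ) (n : ℤ) :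
    gseq q α z n + gseq q α z (n + 2) = (z + z⁻¹ - α * q ^ (-(n + 1))) * gseq q α z (n + 1) := by
  simp only [gseq]
  set Q := q ^ (-(n + 1)) with hQ
  have hQ1 : q ^ (1 - (n + 1)) = Q * q := by
    rw [← zpow_add_one₀ hq0]; congr 1; ring
  have hQ2 : q ^ (1 - n) = Q * q * q := by
    rw [← zpow_add_one₀ hq0, ← zpow_add_one₀ hq0]; congr 1; ring
  rw [hQ1, hQ2, show 1 - (n + 2) = -(n + 1) by ring, ← hQ]
  have z1 : z ^ (-(n + 1)) = z ^ (-n) * z⁻¹ := by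
    rw [← zpow_sub_one₀ hz]; congr 1; ring
  have z2 : z ^ (-(n + 2)) = z ^ (-n) * z⁻¹ * z⁻¹ := by
    rw [← zpow_sub_one₀ hz, ← zpow_sub_one₀ hz]; congr 1; ring
  rw [z1, z2]
  have r1 := phiT_sub_left hq (α * z * Q) (q * z ^ 2)
  have r2 := phiT_sub_right hq (α * z * Q * q) (q * z ^ 2)
  have r3 := phiT_sub_left hq (α * z * Q * q) (q * z ^ 2)
  rw [show α * z * Q * q * q = α * z * (Q * q * q) by ring,
    show α * z * Q * q = α * z * (Q * q) by ring] at *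
  generalize phiT q (α * z * Q) (q * z ^ 2) = P0 at *
  generalize phiT q (α * z * (Q * q)) (q * z ^ 2) = P1 at *
  generalize phiT q (α * z * (Q * q * q)) (q * z ^ 2) = P2 at *
  generalize phiT q (α * z * (Q * q)) (q * z ^ 2 * q) = P3 at *
  generalize phiT q (α * z * (Q * q * q)) (q * z ^ 2 * q) = P4 at *
  have h0 : P0 + z ^ 2 * P2 = (1 + z ^ 2 - α * z * Q) * P1 := by
    linear_combination r1 + α * z * Q * r2 - z ^ 2 * r3
  field_simp
  linear_combination h0

/-- The Casoratian of two solutions of the same three-term recurrence is constant. -/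
lemma casoratian_eq {u v c : ℤ → ℂ} (hu : ∀ n, u n + u (n + 2) = c n * u (n + 1))
    (hv : ∀ n, v n + v (n + 2) = c n * v (n + 1)) (m n : ℤ) :
    u m * v (m + 1) - u (m + 1) * v m = u n * v (n + 1) - u (n + 1) * v n := by
  have step : ∀ k, u (k + 1) * v (k + 2) - u (k + 2) * v (k + 1) =
      u k * v (k + 1) - u (k + 1) * v k := fun k => by
    linear_combination u (k + 1) * hv k - v (k + 1) * hu k
  have key : ∀ k, u k * v (k + 1) - u (k + 1) * v k = u 0 * v 1 - u 1 * v 0 := by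
    intro k
    induction k using Int.induction_on with
    | zero => simp
    | succ i ih => rw [← ih, ← step i]; ring_nf
    | pred i ih =>
      rw [← ih, ← step (-i - 1)]; ring_nf
  rw [key m, key n]

end Recurrence

section Asymptotics

variable {q : ℂ}

lemma tendsto_fPrefactor_mul_qpInf (hq : ‖q‖ < 1) (hq0 : q ≠ 0) {b : ℂ} (hb : b ≠ 0) :
    Tendsto (fun n : ℕ => fPrefactor q b n * qpInf q (b * q ^ (-(n : ℤ)))) atTop
      (𝓝 (theta q b)) := by
  have h : ∀ n : ℕ, fPrefactor q b n * qpInf q (b * q ^ (-(n : ℤ))) =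
      qpInf q b * qp q (q / b) n := by
    intro n
    induction n with
    | zero => simp [fPrefactor_zero, qp]
    | succ n ih =>
      rw [qp, Finset.prod_range_succ, ← qp, ← mul_assoc, ← ih, Nat.cast_succ,
        fPrefactor_succ hq0 hb, qpInf_eq_mul hq,
        show b * q ^ (-((n : ℤ) + 1)) * q = b * q ^ (-(n : ℤ)) by
          rw [mul_assoc, ← zpow_add_one₀ hq0]; congr 2; ring,
        zpow_neg, zpow_add_one₀ hq0, zpow_natCast]
      field_simp
      ring
  simp only [h]
  exact (tendsto_qp hq _).const_mul _

/-- Asymptotics of `₁φ̃₁(0;b q^{-n};q,w)` as `n → ∞`. -/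
lemma tendsto_fPrefactor_mul_phiT (hq : ‖q‖ < 1) (hq0 : q ≠ 0) {b : ℂ} (hb : b ≠ 0) (w : ℂ) :
    Tendsto (fun n : ℕ => fPrefactor q b n * phiT q (b * q ^ (-(n : ℤ))) w) atTop
      (𝓝 (theta q b)) := by
  let t : ℕ → ℕ → ℂ := fun n k => fPrefactor q b n * qpInf q (b * q ^ (-(n : ℤ)) * q ^ k)
  have ht : ∀ n k, t (n + 1) (k + 1) = -(q ^ (n + 1) / b) * t n k := by
    intro n k
    have e : b * q ^ (-((n + 1 : ℕ) : ℤ)) * q ^ (k + 1) = b * q ^ (-(n : ℤ)) * q ^ k := by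
      rw [pow_succ', ← mul_assoc, mul_assoc b _ q, ← zpow_add_one₀ hq0]
      congr 3
      push_cast; ring
    simp only [t]
    rw [e, Nat.cast_succ, fPrefactor_succ hq0 hb, ← Nat.cast_succ, zpow_natCast, mul_assoc]
  have ht0 : Tendsto (fun n => t n 0) atTop (𝓝 (theta q b)) := by
    simpa only [t, pow_zero, mul_one] using tendsto_fPrefactor_mul_qpInf hq hq0 hb
  obtain ⟨M₁, hM₁⟩ := ht0.norm.bddAbove_range
  obtain ⟨M₂, hM₂⟩ : BddAbove (Set.range fun k => ‖t 0 k‖) := by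
    refine Tendsto.bddAbove_range (a := ‖(1 : ℂ)‖) (Tendsto.norm ?_)
    simpa [t, fPrefactor_zero] using tendsto_qpInf_one hq (tendsto_mul_pow_zero hq b)
  set M := max M₁ M₂
  set r := max 1 ‖b‖⁻¹
  have hr : 1 ≤ r := le_max_left _ _
  have hM : 0 ≤ M := (norm_nonneg _).trans ((hM₁ ⟨0, rfl⟩).trans (le_max_left _ _))
  have hbound : ∀ k n, ‖t n k‖ ≤ M * r ^ k := by
    intro k
    induction k with
    | zero =>
      intro n
      rw [pow_zero, mul_one]
      exact (hM₁ ⟨n, rfl⟩).trans (le_max_left _ _)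
    | succ k ih =>
      rintro (_ | n)
      · exact ((hM₂ ⟨k + 1, rfl⟩).trans (le_max_right _ _)).trans
          (le_mul_of_one_le_right hM (one_le_pow₀ hr))
      · rw [ht, norm_mul, norm_neg, norm_div, norm_pow, pow_succ' r, mul_left_comm]
        gcongr
        · rw [div_eq_mul_inv]
          exact (mul_le_of_le_one_left (by positivity)
            (pow_le_one₀ (norm_nonneg q) hq.le)).trans (le_max_right _ _)
        · exact ih n
  have hterm : ∀ n : ℕ, fPrefactor q b n * phiT q (b * q ^ (-(n : ℤ))) w =
      ∑' k, t n k * (phiCoeff q k * w ^ k) := fun n => by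
    rw [phiT_eq_tsum, ← tsum_mul_left]
    exact tsum_congr fun k => by simp only [t]; ring
  simp only [hterm]
  have hlim : ∑' k : ℕ, (if k = 0 then theta q b else 0) * (phiCoeff q k * w ^ k) = theta q b := by
    rw [tsum_eq_single 0 fun k hk => by simp [hk]]
    simp [phiCoeff_zero]
  rw [← hlim]
  refine tendsto_tsum_of_dominated_convergence
    (bound := fun k => M * ‖phiCoeff q k * ((r : ℂ) * w) ^ k‖)
    ((summable_phiCoeff hq _).mul_left _) (fun k => Tendsto.mul_const _ ?_)
    (Eventually.of_forall fun n k => ?_)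
  · rcases k with _ | k
    · simpa using ht0
    · rw [if_neg k.succ_ne_zero, ← tendsto_add_atTop_iff_nat 1]
      simp only [ht]
      refine squeeze_zero_norm (a := fun n => ‖-(q ^ (n + 1) / b)‖ * (M * r ^ k)) (fun n => ?_) ?_
      · rw [norm_mul]
        gcongr
        exact hbound k n
      · have h := ((tendsto_add_atTop_iff_nat 1).2
          (tendsto_pow_atTop_nhds_zero_of_norm_lt_one hq)).div_const b
        simpa using h.neg.norm.mul_const (M * r ^ k)
  · rw [norm_mul, mul_pow, mul_left_comm, norm_mul _ (phiCoeff q k * w ^ k), ← mul_assoc, norm_pow,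
      Complex.norm_real, Real.norm_of_nonneg (by positivity)]
    gcongr
    exact hbound k n

lemma casoratian_gseq_gseq (hq : ‖q‖ < 1) (hq0 : q ≠ 0) {z : ℂ} (hz : z ≠ 0) (α : ℂ) (n : ℤ) :
    gseq q α z n * gseq q α z⁻¹ (n + 1) - gseq q α z (n + 1) * gseq q α z⁻¹ n =
      (z - z⁻¹) * (qpInf q (q * z ^ 2) * qpInf q (q * z⁻¹ ^ 2)) := by
  have hg : ∀ (x : ℂ) (m : ℕ),
      gseq q α x (-m) = x ^ m * phiT q (α * x * q * q ^ m) (q * x ^ 2) := by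
    intro x m
    rw [gseq, neg_neg, zpow_natCast, sub_neg_eq_add, zpow_add₀ hq0, zpow_one, zpow_natCast,
      mul_assoc _ q]
  have hl : ∀ x : ℂ, Tendsto (fun m : ℕ => phiT q (α * x * q * q ^ m) (q * x ^ 2)) atTop
      (𝓝 (qpInf q (q * x ^ 2))) := fun x => by
    rw [← phiT_zero_left hq]
    exact tendsto_phiT hq (tendsto_mul_pow_zero hq _) tendsto_const_nhds
  have hs : ∀ x : ℂ, Tendsto (fun m : ℕ => phiT q (α * x * q * q ^ (m + 1)) (q * x ^ 2)) atTop
      (𝓝 (qpInf q (q * x ^ 2))) := fun x => (tendsto_add_atTop_iff_nat 1).2 (hl x)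
  have hlim := (((hs z).mul (hl z⁻¹)).const_mul z).sub (((hl z).mul (hs z⁻¹)).const_mul z⁻¹)
  rw [sub_mul]
  refine tendsto_nhds_unique (tendsto_const_nhds.congr fun m : ℕ => ?_) hlim
  have hrec := gseq_recurrence hq hq0 (inv_ne_zero hz) α
  simp only [inv_inv, add_comm z⁻¹ z] at hrec
  rw [casoratian_eq (gseq_recurrence hq hq0 hz α) hrec n (-((m + 1 : ℕ) : ℤ)),
    show -((m + 1 : ℕ) : ℤ) + 1 = -(m : ℤ) by push_cast; ring,
    hg, hg, hg, hg]
  have hzm : z ^ m * z⁻¹ ^ m = 1 := by rw [← mul_pow, mul_inv_cancel₀ hz, one_pow]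
  generalize phiT q (α * z * q * q ^ (m + 1)) (q * z ^ 2) = A
  generalize phiT q (α * z * q * q ^ m) (q * z ^ 2) = B
  generalize phiT q (α * z⁻¹ * q * q ^ (m + 1)) (q * z⁻¹ ^ 2) = C
  generalize phiT q (α * z⁻¹ * q * q ^ m) (q * z⁻¹ ^ 2) = D
  rw [pow_succ, pow_succ]
  linear_combination (z * A * D - z⁻¹ * B * C) * hzm

lemma casoratian_fseq_gseq (hq : ‖q‖ < 1) (hq0 : q ≠ 0) {α y z : ℂ} (hα : α ≠ 0) (hz : z ≠ 0)
    (hy : y = z ∨ y = z⁻¹) (n : ℤ) :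
    fseq q α y n * gseq q α z (n + 1) - fseq q α y (n + 1) * gseq q α z n =
      z⁻¹ * theta q (α * z) := by
  have hy0 : y ≠ 0 := by rcases hy with rfl | rfl <;> simp [hz]
  have hyz : y + y⁻¹ = z + z⁻¹ := by
    rcases hy with rfl | rfl
    · rfl
    · rw [inv_inv, add_comm]
  have hf : ∀ m : ℕ, fseq q α y m = fPrefactor q α m *
      phiT q (q / (α * y) * q ^ m) (y * q / α * q ^ m) := by
    intro m
    have e : q ^ ((m : ℤ) + 1) = q ^ m * q := by rw [zpow_add_one₀ hq0, zpow_natCast]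
    rw [fseq, fPrefactor, e]
    congr 2 <;> ring
  have hg : ∀ m : ℕ, gseq q α z (m + 1) =
      z⁻¹ * z ^ (-(m : ℤ)) * phiT q (α * z * q ^ (-(m : ℤ))) (q * z ^ 2) := by
    intro m
    rw [gseq, show 1 - ((m : ℤ) + 1) = -m by ring, neg_add, zpow_add₀ hz, zpow_neg_one,
      mul_comm z⁻¹]
  have hF : Tendsto (fun m : ℕ => phiT q (q / (α * y) * q ^ m) (y * q / α * q ^ m)) atTop
      (𝓝 1) := by
    rw [← phiT_zero_zero (q := q)]
    exact tendsto_phiT hq (tendsto_mul_pow_zero hq _) (tendsto_mul_pow_zero hq _)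
  have hG := tendsto_fPrefactor_mul_phiT hq hq0 (mul_ne_zero hα hz) (q * z ^ 2)
  have h1 : Tendsto (fun m : ℕ => fseq q α y m * gseq q α z (m + 1)) atTop
      (𝓝 (z⁻¹ * theta q (α * z))) := by
    have h := (hF.mul hG).const_mul z⁻¹
    rw [one_mul] at h
    refine h.congr fun m => ?_
    rw [hf, hg, fPrefactor_mul]
    ring
  have h2 : Tendsto (fun m : ℕ => fseq q α y (m + 2) * gseq q α z (m + 1)) atTop (𝓝 0) := by
    have hp := tendsto_mul_pow_zero hq (q / α)
    have h := ((hp.mul (hp.mul_const q)).mul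
      (((tendsto_add_atTop_iff_nat 2).2 hF).mul hG)).mul_const z⁻¹
    simp only [zero_mul] at h
    refine h.congr fun m => ?_
    have hf2 := hf (m + 2)
    push_cast at hf2
    rw [hf2, hg, fPrefactor_mul, show (m : ℤ) + 2 = m + 1 + 1 by ring, fPrefactor_succ hq0 hα,
      fPrefactor_succ hq0 hα, zpow_add_one₀ hq0, zpow_add_one₀ hq0, zpow_natCast]
    ring
  have hlim := ((tendsto_add_atTop_iff_nat 1).2 h1).sub h2
  rw [sub_zero] at hlim
  have hrec := fseq_recurrence hq hq0 hα hy0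
  simp only [hyz] at hrec
  refine tendsto_nhds_unique (tendsto_const_nhds.congr fun m : ℕ => ?_) hlim
  rw [casoratian_eq hrec (gseq_recurrence hq hq0 hz α) n ((m : ℤ) + 1)]
  push_cast
  ring_nf

end Asymptotics

theorem stmt_18 (q : ℝ) (hq0 : 0 < q) (hq1 : q < 1) (α z : ℂ) (hα : α ≠ 0) (hz : z ≠ 0)
    (hz2 : ¬∃ k : ℤ, z ^ 2 = (q : ℂ) ^ k) (n : ℤ) :
    fseq (q : ℂ) α z n =
      theta (q : ℂ) (α * z⁻¹) / theta (q : ℂ) (z ^ (-2 : ℤ)) * gseq (q : ℂ) α z n +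
        theta (q : ℂ) (α * z) / theta (q : ℂ) (z ^ 2) * gseq (q : ℂ) α z⁻¹ n := by
  have hq : ‖(q : ℂ)‖ < 1 := by rwa [Complex.norm_real, Real.norm_of_nonneg hq0.le]
  have hqc : (q : ℂ) ≠ 0 := by exact_mod_cast hq0.ne'
  generalize (q : ℂ) = q at *
  have hne : ∀ k : ℤ, z ^ 2 ≠ q ^ k := fun k h => hz2 ⟨k, h⟩
  have hA : qpInf q (q * z ^ 2) ≠ 0 := qpInf_ne_zero hq fun k h => hne (-(k + 1 : ℕ)) <| by
    rw [zpow_neg, zpow_natCast]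
    exact eq_inv_of_mul_eq_one_left (by rw [← h]; ring)
  have hB : qpInf q (q * z⁻¹ ^ 2) ≠ 0 := qpInf_ne_zero hq fun k h => hne (k + 1 : ℕ) <| by
    rw [zpow_natCast]
    field_simp at h
    rw [← h]
    ring
  have hz1 : 1 - z ^ 2 ≠ 0 := fun h => hne 0 <| by
    rw [zpow_zero]
    linear_combination -h
  have hz1' : z ^ 2 - 1 ≠ 0 := fun h => hz1 (by linear_combination -h)
  have t1 : theta q (z ^ 2) =
      (1 - z ^ 2) * (qpInf q (q * z ^ 2) * qpInf q (q * z⁻¹ ^ 2)) := by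
    rw [theta, qpInf_eq_mul hq (z ^ 2), mul_comm (z ^ 2) q, inv_pow, ← div_eq_mul_inv]
    ring
  have t2 : theta q (z ^ (-2 : ℤ)) =
      (1 - z⁻¹ ^ 2) * (qpInf q (q * z ^ 2) * qpInf q (q * z⁻¹ ^ 2)) := by
    rw [show z ^ (-2 : ℤ) = z⁻¹ ^ 2 by rw [zpow_neg, inv_pow]; norm_cast, theta,
      qpInf_eq_mul hq (z⁻¹ ^ 2), mul_comm (z⁻¹ ^ 2) q, show q / z⁻¹ ^ 2 = q * z ^ 2 by field_simp]
    ring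
  have w1 := casoratian_gseq_gseq hq hqc hz α n
  have w2 := casoratian_fseq_gseq hq hqc hα hz (Or.inl rfl) n
  have w3 := casoratian_fseq_gseq hq hqc hα (inv_ne_zero hz) (Or.inr (inv_inv z).symm) n
  rw [inv_inv] at w3
  rw [t1, t2]
  generalize qpInf q (q * z ^ 2) = A at *
  generalize qpInf q (q * z⁻¹ ^ 2) = B at *
  have key : fseq q α z n * ((z - z⁻¹) * (A * B)) =
      z * theta q (α * z⁻¹) * gseq q α z n - z⁻¹ * theta q (α * z) * gseq q α z⁻¹ n := by
    rw [← w1, ← w2, ← w3]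
    ring
  have hW : (z - z⁻¹) * (A * B) ≠ 0 := by
    refine mul_ne_zero (fun h => hz1' ?_) (mul_ne_zero hA hB)
    field_simp at h
    simpa using h
  rw [eq_div_of_mul_eq hW key]
  have e1 : (1 - z⁻¹ ^ 2) * (A * B) = z⁻¹ * ((z - z⁻¹) * (A * B)) := by field_simp
  have e2 : (1 - z ^ 2) * (A * B) = -z * ((z - z⁻¹) * (A * B)) := by field_simp; ring
  rw [e1, e2]
  generalize (z - z⁻¹) * (A * B) = W at *
  field_simp
  ring
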